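/- In the minimum-counterexample setup, no two neighbors of x are adjacent in G: for all u, v ∈ N_G(x), uv is not an edge of G. -/

import Mathlib

open SimpleGraph

namespace AEC

variable {V : Type*}

/-- The set of colors appearing (under partial coloring `c`) on colored edges incident
with the vertex `u` (i.e. `F_u`). -/
def colorsAt (G : SimpleGraph V) (c : Sym2 V → Option ℕ) (u : V) : Set ℕ :=
  {γ | ∃ z, G.Adj u z ∧ c s(u, z) = some γ}

/-- `S_ab`: the set of colors appearing on the colored edges incident with `b`
other than the edge `ab`. -/
def Sset (G : SimpleGraph V) (c : Sym2 V → Option ℕ) (a b : V) : Set ℕ :=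
  {γ | ∃ z, G.Adj b z ∧ z ≠ a ∧ c s(b, z) = some γ}

/-- A partial edge coloring (colors are `ℕ`, `none` = uncolored): it may only color
edges of `G`, and colored edges sharing an endpoint receive distinct colors. -/
def ProperPartialColoring (G : SimpleGraph V) (c : Sym2 V → Option ℕ) : Prop :=
  (∀ e, (c e).isSome → e ∈ G.edgeSet) ∧
  ∀ ⦃u v w : V⦄, G.Adj u v → G.Adj u w → v ≠ w → (c s(u, v)).isSome →
    c s(u, v) ≠ c s(u, w)

/-- A valid (acyclic) partial coloring: proper, and no cycle of `G` is bichromatic,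
i.e. no cycle has all of its edges colored using only two colors. -/
def AcyclicPartialColoring (G : SimpleGraph V) (c : Sym2 V → Option ℕ) : Prop :=
  ProperPartialColoring G c ∧
  ∀ (α β : ℕ) (v : V) (W : G.Walk v v), W.IsCycle →
    ¬ ∀ e ∈ W.edges, c e = some α ∨ c e = some β

/-- An acyclic edge coloring of `G` using (at most) `k` colors: a valid partial coloring
that colors every edge of `G` with a color `< k`. -/
def IsAcyclicEdgeColoring (G : SimpleGraph V) (k : ℕ) (c : Sym2 V → Option ℕ) : Prop :=
  AcyclicPartialColoring G c ∧ ∀ e ∈ G.edgeSet, ∃ a, a < k ∧ c e = some a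

/-- `G` is 2-degenerate: every nonempty (induced) subgraph has a vertex of degree at most 2. -/
def TwoDegenerate [DecidableEq V] (G : SimpleGraph V) [DecidableRel G.Adj] : Prop :=
  ∀ s : Finset V, s.Nonempty → ∃ v ∈ s, (s.filter fun u => G.Adj v u).card ≤ 2

/-- A maximal `(α,β)`-bichromatic path from `a` to `b`: a path all of whose edges are
colored `α` or `β`, which cannot be extended at either end. -/
def IsMaximalBichromaticPath (G : SimpleGraph V) (c : Sym2 V → Option ℕ)
    (α β : ℕ) {a b : V} (W : G.Walk a b) : Prop :=
  W.IsPath ∧ (∀ e ∈ W.edges, c e = some α ∨ c e = some β) ∧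
  (∀ w, G.Adj a w → (c s(a, w) = some α ∨ c s(a, w) = some β) → w ∈ W.support) ∧
  (∀ w, G.Adj b w → (c s(b, w) = some α ∨ c s(b, w) = some β) → w ∈ W.support)

/-- An `(α,β,a,b)`-maximal bichromatic path: a maximal `(α,β)`-bichromatic path from
`a` to `b` whose edge incident on `a` is colored `α`. -/
def IsMaxBichromaticPathFrom (G : SimpleGraph V) (c : Sym2 V → Option ℕ)
    (α β : ℕ) {a b : V} (W : G.Walk a b) : Prop :=
  IsMaximalBichromaticPath G c α β W ∧ ∃ e, W.edges.head? = some e ∧ c e = some α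

/-- An `(α,β,ab)`-critical path: a maximal `(α,β)`-bichromatic path from `a` to `b` whose
edges incident on `a` and on `b` are both colored `α`. -/
def IsCriticalPath (G : SimpleGraph V) (c : Sym2 V → Option ℕ)
    (α β : ℕ) {a b : V} (W : G.Walk a b) : Prop :=
  IsMaxBichromaticPathFrom G c α β W ∧ ∃ e, W.edges.getLast? = some e ∧ c e = some α

/-- `F''_x(c)`: colors of edges from `x` to its neighbors (other than `y`) of degree ≥ 3. -/
def Fpp [Fintype V] (G : SimpleGraph V) [DecidableRel G.Adj]
    (c : Sym2 V → Option ℕ) (x y : V) : Set ℕ :=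
  {γ | ∃ z, G.Adj x z ∧ z ≠ y ∧ 3 ≤ G.degree z ∧ c s(x, z) = some γ}

/-- `F'_x(c)`: colors of edges from `x` to its neighbors (other than `y`) of degree 2. -/
def Fp [Fintype V] (G : SimpleGraph V) [DecidableRel G.Adj]
    (c : Sym2 V → Option ℕ) (x y : V) : Set ℕ :=
  {γ | ∃ z, G.Adj x z ∧ z ≠ y ∧ G.degree z = 2 ∧ c s(x, z) = some γ}

/-- `F_x(c) = F'_x(c) ∪ F''_x(c)`. -/
def Fx [Fintype V] (G : SimpleGraph V) [DecidableRel G.Adj]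
    (c : Sym2 V → Option ℕ) (x y : V) : Set ℕ :=
  Fp G c x y ∪ Fpp G c x y

/-- The subgraph formed by the edges colored `α` or `β`. -/
def bichromatic (c : Sym2 V → Option ℕ) (α β : ℕ) : SimpleGraph V :=
  fromEdgeSet {e | c e = some α ∨ c e = some β}

/-- The color `a` appears at the vertex `p`. -/
def Sees (c : Sym2 V → Option ℕ) (p : V) (a : ℕ) : Prop :=
  ∃ q, c s(p, q) = some a

/-- A reformulation of `AcyclicPartialColoring` in terms of the two-colored subgraphs. -/
structure Valid (G : SimpleGraph V) (c : Sym2 V → Option ℕ) : Prop where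
  mem : ∀ e a, c e = some a → e ∈ G.edgeSet
  proper : ∀ u v w a, c s(u, v) = some a → c s(u, w) = some a → v = w
  acyclic : ∀ α β, (bichromatic c α β).IsAcyclic

theorem bichromatic_adj {c : Sym2 V → Option ℕ} {α β : ℕ} {u v : V} :
    (bichromatic c α β).Adj u v ↔ (c s(u, v) = some α ∨ c s(u, v) = some β) ∧ u ≠ v := by
  simp [bichromatic]

theorem bichromatic_mono {c d : Sym2 V → Option ℕ} {α β : ℕ}
    (h : ∀ e, (c e = some α ∨ c e = some β) → d e = c e) :
    bichromatic c α β ≤ bichromatic d α β := by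
  intro u v huv
  rw [bichromatic_adj] at huv ⊢
  rwa [h _ huv.1]

theorem acyclicPartialColoring_iff_valid {G : SimpleGraph V} {c : Sym2 V → Option ℕ} :
    AcyclicPartialColoring G c ↔ Valid G c := by
  constructor
  · rintro ⟨⟨h1, h2⟩, h3⟩
    have hm : ∀ e a, c e = some a → e ∈ G.edgeSet := fun e a h => h1 e (by simp [h])
    refine ⟨hm, fun u v w a hv hw => ?_, fun α β v W hW => ?_⟩
    · by_contra hne
      exact h2 (hm _ _ hv) (hm _ _ hw) hne (by simp [hv]) (hv.trans hw.symm)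
    · have hle : bichromatic c α β ≤ G := by
        intro u v huv
        rw [bichromatic_adj] at huv
        exact huv.1.elim (hm _ _) (hm _ _)
      refine h3 α β v (W.mapLe hle) (hW.mapLe hle) fun e he => ?_
      rw [Walk.edges_mapLe_eq_edges] at he
      have := W.edges_subset_edgeSet he
      induction e with
      | _ p q => exact (bichromatic_adj.1 this).1
  · rintro ⟨h1, h2, h3⟩
    refine ⟨⟨fun e he => ?_, fun u v w _ _ hne hs heq => ?_⟩, fun α β v W hW hcol => ?_⟩
    · obtain ⟨a, ha⟩ := Option.isSome_iff_exists.1 he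
      exact h1 e a ha
    · obtain ⟨a, ha⟩ := Option.isSome_iff_exists.1 hs
      exact hne (h2 u v w a ha (heq ▸ ha))
    · have hH : ∀ e ∈ W.edges, e ∈ (bichromatic c α β).edgeSet := by
        intro e he
        have hG := W.edges_subset_edgeSet he
        have hc := hcol e he
        induction e with
        | _ p q => exact bichromatic_adj.2 ⟨hc, G.ne_of_adj hG⟩
      exact h3 α β _ (hW.transfer hH)

theorem Valid.mono {G G' : SimpleGraph V} {c : Sym2 V → Option ℕ} (h : Valid G c)
    (hle : G ≤ G') : Valid G' c :=
  ⟨fun e a he => edgeSet_mono hle (h.mem e a he), h.proper, h.acyclic⟩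

theorem Valid.adj {G : SimpleGraph V} {c : Sym2 V → Option ℕ} (h : Valid G c) {u v : V} {a : ℕ}
    (huv : c s(u, v) = some a) : G.Adj u v :=
  h.mem _ _ huv

theorem mem_of_reachable_of_closed {H : SimpleGraph V} {S : Set V}
    (hS : ∀ p ∈ S, ∀ q, H.Adj p q → q ∈ S) {x y : V} (h : H.Reachable x y) (hx : x ∈ S) :
    y ∈ S := by
  obtain ⟨W⟩ := h
  induction W with
  | nil => exact hx
  | cons hadj _ ih => exact ih (hS _ hx _ hadj)

section Update

variable [DecidableEq V]

theorem update_mk (c : Sym2 V → Option ℕ) (x y p q : V) (o : Option ℕ) :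
    Function.update c s(x, y) o s(p, q) =
      if p = x ∧ q = y ∨ p = y ∧ q = x then o else c s(p, q) := by
  simp [Function.update_apply]

theorem Valid.uncolor {G : SimpleGraph V} {c : Sym2 V → Option ℕ} (h : Valid G c) (e : Sym2 V) :
    Valid G (Function.update c e none) := by
  have key : ∀ f a, Function.update c e none f = some a → c f = some a := by
    intro f a hf
    rw [Function.update_apply] at hf
    split_ifs at hf
    exact hf
  refine ⟨fun f a hf => h.mem f a (key f a hf), fun u v w a hv hw =>
    h.proper u v w a (key _ _ hv) (key _ _ hw), fun α β => (h.acyclic α β).anti ?_⟩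
  refine bichromatic_mono fun f hf => ?_
  rcases hf with hf | hf <;> rw [hf, key _ _ hf]

theorem Valid.color {G : SimpleGraph V} {c : Sym2 V → Option ℕ} (h : Valid G c) {x y : V} {a : ℕ}
    (hadj : G.Adj x y) (hnone : c s(x, y) = none) (hx : ¬ Sees c x a) (hy : ¬ Sees c y a)
    (hr : ∀ b, Sees c x b → Sees c y b → ¬ (bichromatic c a b).Reachable x y) :
    Valid G (Function.update c s(x, y) (some a)) := by
  have hne := hadj.ne
  have hr' : ∀ b, ¬ (bichromatic c a b).Reachable x y := by
    intro b hb
    refine hr b ?_ ?_ hb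
    · by_contra hxb
      have := mem_of_reachable_of_closed (S := {x}) (by
        rintro p rfl q hq
        rcases (bichromatic_adj.1 hq).1 with hq | hq
        exacts [(hx ⟨q, hq⟩).elim, (hxb ⟨q, hq⟩).elim]) hb rfl
      exact hne this.symm
    · by_contra hyb
      have := mem_of_reachable_of_closed (S := {y}) (by
        rintro p rfl q hq
        rcases (bichromatic_adj.1 hq).1 with hq | hq
        exacts [(hy ⟨q, hq⟩).elim, (hyb ⟨q, hq⟩).elim]) hb.symm rfl
      exact hne this
  have hxy : ∀ b, (bichromatic (Function.update c s(x, y) (some a)) a b).IsAcyclic := by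
    intro b
    refine ((h.acyclic a b).sup_edge_of_not_reachable (hr' b)).anti ?_
    intro p q hpq
    rw [bichromatic_adj, update_mk] at hpq
    rw [sup_adj, bichromatic_adj, edge_adj]
    grind
  refine ⟨fun e b he => ?_, fun u v w b hv hw => ?_, fun α β => ?_⟩
  · rw [Function.update_apply] at he
    split_ifs at he with hxe
    · rw [hxe]; exact hadj
    · exact h.mem e b he
  · have h1 : ∀ q, c s(x, q) ≠ some a := fun q hq => hx ⟨q, hq⟩
    have h2 : ∀ q, c s(y, q) ≠ some a := fun q hq => hy ⟨q, hq⟩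
    have h3 := h.proper u v w b
    rw [update_mk] at hv hw
    grind
  · by_cases hα : α = a
    · subst hα; exact hxy β
    by_cases hβ : β = a
    · subst hβ
      refine (hxy α).anti fun p q hpq => ?_
      rw [bichromatic_adj] at hpq ⊢
      exact ⟨hpq.1.symm, hpq.2⟩
    refine (h.acyclic α β).anti (bichromatic_mono fun e he => ?_)
    rw [Function.update_apply] at he ⊢
    grind

end Update

/-- In a graph of maximum degree at most two, a component has at most two ends: two paths leaving
`p` away from a common neighbor `r` lead to the same end. -/
theorem eq_of_paths_to_ends {H : SimpleGraph V}
    (hH : ∀ p a b c, H.Adj p a → H.Adj p b → H.Adj p c → a = b ∨ a = c ∨ b = c)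
    {y z r : V} (hy : ∀ a b, H.Adj y a → H.Adj y b → a = b)
    (hz : ∀ a b, H.Adj z a → H.Adj z b → a = b) {p : V} (hr : H.Adj p r)
    (P : H.Walk p y) (Q : H.Walk p z) (hP : P.IsPath) (hQ : Q.IsPath)
    (hrP : r ∉ P.support) (hrQ : r ∉ Q.support) : y = z := by
  induction P generalizing r with
  | nil =>
    cases Q with
    | nil => rfl
    | cons h Q' =>
      have := hy _ _ hr h
      subst this
      simp at hrQ
  | @cons p p' y h P' ih =>
    cases Q with
    | nil =>
      have := hz _ _ hr h
      subst this
      simp at hrP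
    | @cons _ q' _ h' Q' =>
      rw [Walk.cons_isPath_iff] at hP hQ
      simp only [Walk.support_cons, List.mem_cons, not_or] at hrP hrQ
      have hpq : p' = q' := by
        rcases hH _ _ _ _ hr h h' with e | e | e
        · subst e; simp at hrP
        · subst e; simp at hrQ
        · exact e
      subst hpq
      exact ih hy h.symm Q' hP.1 hQ.1 hP.2 hQ.2

theorem eq_of_reachable_ends {H : SimpleGraph V}
    (hH : ∀ p a b c, H.Adj p a → H.Adj p b → H.Adj p c → a = b ∨ a = c ∨ b = c)
    {x y z : V} (hx : ∀ a b, H.Adj x a → H.Adj x b → a = b)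
    (hy : ∀ a b, H.Adj y a → H.Adj y b → a = b)
    (hz : ∀ a b, H.Adj z a → H.Adj z b → a = b) (hxy : H.Reachable x y) (hxz : H.Reachable x z)
    (hney : x ≠ y) (hnez : x ≠ z) : y = z := by
  classical
  obtain ⟨P, hP⟩ := hxy.exists_isPath
  obtain ⟨Q, hQ⟩ := hxz.exists_isPath
  cases P with
  | nil => exact (hney rfl).elim
  | cons h P' =>
    cases Q with
    | nil => exact (hnez rfl).elim
    | cons h' Q' =>
      have := hx _ _ h h'
      subst this
      rw [Walk.cons_isPath_iff] at hP hQ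
      exact eq_of_paths_to_ends hH hy hz h.symm P' Q' hP.1 hQ.1 hP.2 hQ.2

theorem Valid.eq_of_reachable {G : SimpleGraph V} {c : Sym2 V → Option ℕ} (h : Valid G c)
    {a b : ℕ} {x y z : V} (hx : ¬ Sees c x a) (hy : ¬ Sees c y a) (hz : ¬ Sees c z a)
    (hxy : (bichromatic c a b).Reachable x y) (hxz : (bichromatic c a b).Reachable x z)
    (hney : x ≠ y) (hnez : x ≠ z) : y = z := by
  have hend : ∀ v, ¬ Sees c v a → ∀ p q, (bichromatic c a b).Adj v p →
      (bichromatic c a b).Adj v q → p = q := by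
    intro v hv p q hp hq
    rw [bichromatic_adj] at hp hq
    exact h.proper v p q b (hp.1.resolve_left fun e => hv ⟨p, e⟩)
      (hq.1.resolve_left fun e => hv ⟨q, e⟩)
  refine eq_of_reachable_ends (fun p q r s hq hr hs => ?_) (hend x hx) (hend y hy) (hend z hz)
    hxy hxz hney hnez
  rw [bichromatic_adj] at hq hr hs
  have := h.proper p
  grind

/-- The other color occurs at the second vertex of a two-colored path with ends `x` and `y`. -/
theorem Valid.sees_of_reachable {G : SimpleGraph V} {c : Sym2 V → Option ℕ} (h : Valid G c)
    {a b : ℕ} {x y w : V} (hxy : (bichromatic c a b).Reachable x y) (hx : ¬ Sees c x a)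
    (hw : c s(x, w) = some b) (hyx : y ≠ x) (hyw : y ≠ w) : Sees c w a := by
  by_contra hwa
  have := mem_of_reachable_of_closed (S := {x, w}) (by
    rintro p (rfl | rfl) q hq
    · refine Or.inr ?_
      rcases (bichromatic_adj.1 hq).1 with hq | hq
      exacts [(hx ⟨q, hq⟩).elim, h.proper _ _ _ _ hq hw]
    · refine Or.inl ?_
      rcases (bichromatic_adj.1 hq).1 with hq | hq
      exacts [(hwa ⟨q, hq⟩).elim, h.proper _ _ _ _ hq (Sym2.eq_swap ▸ hw)]) hxy (Or.inl rfl)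
  exact this.elim hyx hyw

/-- The first color occurs at the third vertex of a two-colored path with ends `x` and `y`. -/
theorem Valid.sees_third_of_reachable {G : SimpleGraph V} {c : Sym2 V → Option ℕ} (h : Valid G c)
    {a b : ℕ} {x y w t : V} (hxy : (bichromatic c a b).Reachable x y) (hx : ¬ Sees c x a)
    (hw : c s(x, w) = some b) (ht : c s(w, t) = some a)
    (hyx : y ≠ x) (hyw : y ≠ w) (hyt : y ≠ t) : Sees c t b := by
  by_contra htb
  have := mem_of_reachable_of_closed (S := {x, w, t}) (by
    rintro p (rfl | rfl | rfl) q hq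
    · refine Or.inr (Or.inl ?_)
      rcases (bichromatic_adj.1 hq).1 with hq | hq
      exacts [(hx ⟨q, hq⟩).elim, h.proper _ _ _ _ hq hw]
    · rcases (bichromatic_adj.1 hq).1 with hq | hq
      exacts [Or.inr (Or.inr (h.proper _ _ _ _ hq ht)),
        Or.inl (h.proper _ _ _ _ hq (Sym2.eq_swap ▸ hw))]
    · refine Or.inr (Or.inl ?_)
      rcases (bichromatic_adj.1 hq).1 with hq | hq
      exacts [h.proper _ _ _ _ hq (Sym2.eq_swap ▸ ht), (htb ⟨q, hq⟩).elim]) hxy (Or.inl rfl)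
  exact this.elim hyx fun h => h.elim hyw hyt

section Counting

variable [Fintype V] {G : SimpleGraph V} [DecidableRel G.Adj] {c : Sym2 V → Option ℕ}

theorem Valid.exists_unseen_pair [DecidableEq V] (h : Valid G c) {x y : V} (hadj : G.Adj x y)
    (hnone : c s(x, y) = none) :
    ∃ a₁ a₂, a₁ ≠ a₂ ∧ a₁ < G.maxDegree + 1 ∧ a₂ < G.maxDegree + 1 ∧
      ¬ Sees c x a₁ ∧ ¬ Sees c x a₂ := by
  set F := ((G.neighborFinset x).erase y).image fun q => (c s(x, q)).getD 0 with hF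
  have hseen : ∀ a, Sees c x a → a ∈ F := by
    rintro a ⟨q, hq⟩
    refine Finset.mem_image.2 ⟨q, Finset.mem_erase.2 ⟨?_, ?_⟩, by simp [hq]⟩
    · rintro rfl; simp [hnone] at hq
    · exact (G.mem_neighborFinset x q).2 (h.adj hq)
  have hmem : y ∈ G.neighborFinset x := (G.mem_neighborFinset x y).2 hadj
  have hcard : F.card + 1 ≤ G.maxDegree := by
    have h1 : F.card ≤ ((G.neighborFinset x).erase y).card := Finset.card_image_le
    have h2 := Finset.card_erase_add_one hmem
    have h3 := G.degree_le_maxDegree x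
    rw [← G.card_neighborFinset_eq_degree] at h3
    omega
  have hdiff : 1 < (Finset.range (G.maxDegree + 1) \ F).card := by
    have := Finset.le_card_sdiff F (Finset.range (G.maxDegree + 1))
    rw [Finset.card_range] at this
    omega
  obtain ⟨a₁, h₁, a₂, h₂, hne⟩ := Finset.one_lt_card.1 hdiff
  rw [Finset.mem_sdiff, Finset.mem_range] at h₁ h₂
  exact ⟨a₁, a₂, hne, h₁.1, h₂.1, fun hs => h₁.2 (hseen _ hs), fun hs => h₂.2 (hseen _ hs)⟩

theorem Valid.card_le_degree (h : Valid G c) {p : V} (s : Finset ℕ) (hs : ∀ a ∈ s, Sees c p a) :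
    s.card ≤ G.degree p := by
  classical
  rw [← G.card_neighborFinset_eq_degree]
  refine (Finset.card_le_card (t := (G.neighborFinset p).image fun q => (c s(p, q)).getD 0)
    fun a ha => ?_).trans Finset.card_image_le
  obtain ⟨q, hq⟩ := hs a ha
  exact Finset.mem_image.2 ⟨q, (G.mem_neighborFinset p q).2 (h.adj hq), by simp [hq]⟩

theorem Valid.exists_unseen (h : Valid G c) (p : V) :
    ∃ a < G.maxDegree + 1, ¬ Sees c p a := by
  by_contra! hall
  have := h.card_le_degree (p := p) (Finset.range (G.maxDegree + 1))
    fun a ha => hall a (Finset.mem_range.1 ha)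
  rw [Finset.card_range] at this
  have := G.degree_le_maxDegree p
  omega

theorem Valid.three_le_degree (h : Valid G c) {p : V} {a₁ a₂ b : ℕ} (h₁ : Sees c p a₁)
    (h₂ : Sees c p a₂) (hb : Sees c p b) (h₁₂ : a₁ ≠ a₂) (h₁b : a₁ ≠ b) (h₂b : a₂ ≠ b) :
    3 ≤ G.degree p := by
  have := h.card_le_degree (p := p) {a₁, a₂, b} (by simp [h₁, h₂, hb])
  rwa [Finset.card_eq_three.2 ⟨a₁, a₂, b, h₁₂, h₁b, h₂b, rfl⟩] at this

theorem exists_other_neighbor {x y : V} (hadj : G.Adj x y) (hdeg : G.degree y = 2) :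
    ∃ y', x ≠ y' ∧ G.Adj y y' ∧ ∀ q, G.Adj y q → q = x ∨ q = y' := by
  classical
  rw [← G.card_neighborFinset_eq_degree, Finset.card_eq_two] at hdeg
  obtain ⟨p, q, hpq, hN⟩ := hdeg
  have hN' : ∀ r, G.Adj y r ↔ r = p ∨ r = q := fun r => by
    rw [← G.mem_neighborFinset, hN]; simp
  rcases (hN' x).1 hadj.symm with rfl | rfl
  · exact ⟨q, hpq, (hN' q).2 (Or.inr rfl), fun r hr => (hN' r).1 hr⟩
  · exact ⟨p, hpq.symm, (hN' p).2 (Or.inl rfl), fun r hr => ((hN' r).1 hr).symm⟩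

end Counting

section Near

variable [Fintype V] {G : SimpleGraph V} [DecidableRel G.Adj]
  {x y y' : V} {c : Sym2 V → Option ℕ}

/-- A valid coloring with `Δ + 1` colors of all the edges but `xy`. -/
structure Near (G : SimpleGraph V) [DecidableRel G.Adj] (c : Sym2 V → Option ℕ)
    (x y : V) : Prop where
  valid : Valid G c
  adj : G.Adj x y
  uncolored : c s(x, y) = none
  full : ∀ e ∈ G.edgeSet, e ≠ s(x, y) → ∃ a, a < G.maxDegree + 1 ∧ c e = some a

theorem exists_near (hdel : ∀ e ∈ G.edgeSet, ∃ c : Sym2 V → Option ℕ,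
      IsAcyclicEdgeColoring (G.deleteEdges {e}) (G.maxDegree + 1) c) (hadj : G.Adj x y) :
    ∃ c, Near G c x y := by
  obtain ⟨c, hc, hfull⟩ := hdel s(x, y) hadj
  rw [acyclicPartialColoring_iff_valid] at hc
  refine ⟨c, hc.mono (deleteEdges_le _), hadj, ?_, fun e he hne => hfull e ?_⟩
  · by_contra hsome
    obtain ⟨a, ha⟩ := Option.ne_none_iff_exists'.1 hsome
    have := hc.mem _ _ ha
    simp at this
  · simp [he, hne]

theorem Near.eq_of_sees (h : Near G c x y) (hy : ∀ q, G.Adj y q → q = x ∨ q = y')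
    {a b : ℕ} (hb : c s(y, y') = some b) (ha : Sees c y a) : a = b := by
  obtain ⟨q, hq⟩ := ha
  rcases hy q (h.valid.adj hq) with rfl | rfl
  · rw [Sym2.eq_swap, h.uncolored] at hq
    cases hq
  · exact Option.some_injective _ (hq.symm.trans hb)

/-- A valid coloring with `Δ + 1` colors of all the edges but the two edges `xy` and `yy'` at a
vertex `y` of degree two. -/
structure Base (G : SimpleGraph V) [DecidableRel G.Adj] (c : Sym2 V → Option ℕ)
    (x y y' : V) : Prop where
  valid : Valid G c
  adj : G.Adj x y
  adj' : G.Adj y y'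
  ne : x ≠ y'
  nbr : ∀ q, G.Adj y q → q = x ∨ q = y'
  uncolored : c s(x, y) = none
  uncolored' : c s(y, y') = none
  full : ∀ e ∈ G.edgeSet, e ≠ s(x, y) → e ≠ s(y, y') →
    ∃ a, a < G.maxDegree + 1 ∧ c e = some a

theorem Base.not_sees (h : Base G c x y y') (a : ℕ) : ¬ Sees c y a := by
  rintro ⟨q, hq⟩
  rcases h.nbr q (h.valid.adj hq) with rfl | rfl
  · rw [Sym2.eq_swap, h.uncolored] at hq
    cases hq
  · rw [h.uncolored'] at hq
    cases hq

variable [DecidableEq V]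

theorem Near.exists_reachable (hmin : ¬ ∃ c, IsAcyclicEdgeColoring G (G.maxDegree + 1) c)
    (h : Near G c x y) {a : ℕ} (ha : a < G.maxDegree + 1) (hx : ¬ Sees c x a)
    (hy : ¬ Sees c y a) :
    ∃ b, Sees c x b ∧ Sees c y b ∧ (bichromatic c a b).Reachable x y := by
  by_contra! hno
  have hv := h.valid.color h.adj h.uncolored hx hy hno
  refine hmin ⟨_, acyclicPartialColoring_iff_valid.2 hv, fun e he => ?_⟩
  by_cases hxe : e = s(x, y)
  · exact ⟨a, ha, by rw [hxe, Function.update_self]⟩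
  · rw [Function.update_of_ne hxe]
    exact h.full e he hxe

theorem Near.two_le_degree (hmin : ¬ ∃ c, IsAcyclicEdgeColoring G (G.maxDegree + 1) c)
    (h : Near G c x y) : 2 ≤ G.degree y := by
  by_contra! hlt
  have hsingle : ∀ q, G.Adj y q → q = x := by
    intro q hq
    rw [← G.card_neighborFinset_eq_degree, Nat.lt_succ_iff, Finset.card_le_one] at hlt
    exact hlt q (by simpa) x (by simpa using h.adj.symm)
  have hsees : ∀ a, ¬ Sees c y a := by
    rintro a ⟨q, hq⟩
    have := hsingle q (h.valid.adj hq)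
    subst this
    rw [Sym2.eq_swap, h.uncolored] at hq
    cases hq
  obtain ⟨a, -, -, ha, -, hxa, -⟩ := h.valid.exists_unseen_pair h.adj h.uncolored
  obtain ⟨b, -, hb, -⟩ := h.exists_reachable hmin ha hxa (hsees a)
  exact hsees b hb

section DegreeTwo

variable {b : ℕ}

theorem Near.sees_end (hmin : ¬ ∃ c, IsAcyclicEdgeColoring G (G.maxDegree + 1) c)
    (h : Near G c x y) (hy : ∀ q, G.Adj y q → q = x ∨ q = y') (hb : c s(y, y') = some b) :
    Sees c x b := by
  obtain ⟨a₁, a₂, hne, h₁, h₂, hx₁, hx₂⟩ := h.valid.exists_unseen_pair h.adj h.uncolored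
  obtain ⟨a, ha, hxa, hab⟩ : ∃ a < G.maxDegree + 1, ¬ Sees c x a ∧ a ≠ b := by
    by_cases h₁b : a₁ = b
    · exact ⟨a₂, h₂, hx₂, fun e => hne (h₁b.trans e.symm)⟩
    · exact ⟨a₁, h₁, hx₁, h₁b⟩
  obtain ⟨b', hxb', hyb', -⟩ :=
    h.exists_reachable hmin ha hxa fun hs => hab (h.eq_of_sees hy hb hs)
  rwa [h.eq_of_sees hy hb hyb'] at hxb'

theorem Near.reachable (hmin : ¬ ∃ c, IsAcyclicEdgeColoring G (G.maxDegree + 1) c)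
    (h : Near G c x y) (hy : ∀ q, G.Adj y q → q = x ∨ q = y') (hb : c s(y, y') = some b)
    {a : ℕ} (ha : a < G.maxDegree + 1) (hx : ¬ Sees c x a) :
    (bichromatic c a b).Reachable x y := by
  have hab : a ≠ b := by
    rintro rfl
    exact hx (h.sees_end hmin hy hb)
  obtain ⟨b', -, hyb', hr⟩ :=
    h.exists_reachable hmin ha hx fun hs => hab (h.eq_of_sees hy hb hs)
  rwa [h.eq_of_sees hy hb hyb'] at hr

theorem Near.exists_three_le_degree
    (hmin : ¬ ∃ c, IsAcyclicEdgeColoring G (G.maxDegree + 1) c)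
    (h : Near G c x y) (hy : ∀ q, G.Adj y q → q = x ∨ q = y') (hb : c s(y, y') = some b) :
    ∃ w, c s(x, w) = some b ∧ 3 ≤ G.degree w := by
  have hxb := h.sees_end hmin hy hb
  obtain ⟨w, hw⟩ := hxb
  obtain ⟨a₁, a₂, hne, h₁, h₂, hx₁, hx₂⟩ := h.valid.exists_unseen_pair h.adj h.uncolored
  have hyw : y ≠ w := by
    rintro rfl
    rw [h.uncolored] at hw
    cases hw
  refine ⟨w, hw, h.valid.three_le_degree (a₁ := a₁) (a₂ := a₂) (b := b) ?_ ?_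
    ⟨x, Sym2.eq_swap ▸ hw⟩ hne ?_ ?_⟩
  · exact h.valid.sees_of_reachable (h.reachable hmin hy hb h₁ hx₁) hx₁ hw h.adj.ne' hyw
  · exact h.valid.sees_of_reachable (h.reachable hmin hy hb h₂ hx₂) hx₂ hw h.adj.ne' hyw
  · rintro rfl; exact hx₁ ⟨w, hw⟩
  · rintro rfl; exact hx₂ ⟨w, hw⟩

theorem Near.three_le_degree_other
    (hmin : ¬ ∃ c, IsAcyclicEdgeColoring G (G.maxDegree + 1) c)
    (h : Near G c x y) (hy : ∀ q, G.Adj y q → q = x ∨ q = y') (hxy' : x ≠ y')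
    (hb : c s(y, y') = some b) : 3 ≤ G.degree y' := by
  have hxb := h.sees_end hmin hy hb
  obtain ⟨a₁, a₂, hne, h₁, h₂, hx₁, hx₂⟩ := h.valid.exists_unseen_pair h.adj h.uncolored
  have hb₁ : a₁ ≠ b := by rintro rfl; exact hx₁ hxb
  have hb₂ : a₂ ≠ b := by rintro rfl; exact hx₂ hxb
  refine h.valid.three_le_degree (a₁ := a₁) (a₂ := a₂) (b := b) ?_ ?_
    ⟨y, Sym2.eq_swap ▸ hb⟩ hne hb₁ hb₂
  · exact h.valid.sees_of_reachable (h.reachable hmin hy hb h₁ hx₁).symm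
      (fun hs => hb₁ (h.eq_of_sees hy hb hs)) hb h.adj.ne hxy'
  · exact h.valid.sees_of_reachable (h.reachable hmin hy hb h₂ hx₂).symm
      (fun hs => hb₂ (h.eq_of_sees hy hb hs)) hb h.adj.ne hxy'

end DegreeTwo

theorem Near.base (h : Near G c x y) (hadj' : G.Adj y y') (hne : x ≠ y')
    (hy : ∀ q, G.Adj y q → q = x ∨ q = y') :
    Base G (Function.update c s(y, y') none) x y y' where
  valid := h.valid.uncolor _
  adj := h.adj
  adj' := hadj'
  ne := hne
  nbr := hy
  uncolored := by
    rw [update_mk, h.uncolored]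
    simp
  uncolored' := Function.update_self ..
  full e he h₁ h₂ := by
    rw [Function.update_of_ne h₂]
    exact h.full e he h₁

theorem Base.near (h : Base G c x y y') {b : ℕ} (hb : b < G.maxDegree + 1)
    (hy' : ¬ Sees c y' b) : Near G (Function.update c s(y, y') (some b)) x y where
  valid := h.valid.color h.adj' h.uncolored' (h.not_sees b) hy'
    fun a ha => (h.not_sees a ha).elim
  adj := h.adj
  uncolored := by
    have := h.ne
    have := h.adj.ne
    rw [update_mk, h.uncolored]
    grind
  full e he hne := by
    by_cases hye : e = s(y, y')
    · exact ⟨b, hb, by rw [hye, Function.update_self]⟩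
    · rw [Function.update_of_ne hye]
      exact h.full e he hne hye

/-- If the color `b` is free at the far end of the edge `yy'`, then it is used by `x` on an edge to
a vertex of degree at least three. -/
theorem Base.exists_three_le_degree
    (hmin : ¬ ∃ c, IsAcyclicEdgeColoring G (G.maxDegree + 1) c) (h : Base G c x y y') {b : ℕ}
    (hb : b < G.maxDegree + 1) (hy' : ¬ Sees c y' b) :
    ∃ w, c s(x, w) = some b ∧ 3 ≤ G.degree w := by
  obtain ⟨w, hw, hdeg⟩ :=
    (h.near hb hy').exists_three_le_degree hmin h.nbr (Function.update_self ..)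
  refine ⟨w, ?_, hdeg⟩
  have := h.ne
  have := h.adj.ne
  rw [update_mk] at hw
  grind

theorem Base.three_le_degree_other
    (hmin : ¬ ∃ c, IsAcyclicEdgeColoring G (G.maxDegree + 1) c) (h : Base G c x y y') :
    3 ≤ G.degree y' := by
  obtain ⟨b, -, -, hb, -, hy', -⟩ :=
    h.valid.exists_unseen_pair h.adj'.symm (Sym2.eq_swap ▸ h.uncolored')
  exact (h.near hb hy').three_le_degree_other hmin h.nbr h.ne (Function.update_self ..)

/-- For every color `a` other than the two colors `b₁, b₂` free at `y'`, once `yy'` is colored by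
`b ∈ {b₁, b₂}` and the color `a` is removed at `x`, there is an `(a, b)`-colored path from `x`
to `y`. -/
theorem Base.exists_reachable
    (hmin : ¬ ∃ c, IsAcyclicEdgeColoring G (G.maxDegree + 1) c) (h : Base G c x y y')
    {b₁ b₂ : ℕ} {w₁ w₂ : V} (hw₁ : c s(x, w₁) = some b₁) (hw₂ : c s(x, w₂) = some b₂)
    (hlt₁ : b₁ < G.maxDegree + 1) (hlt₂ : b₂ < G.maxDegree + 1)
    (hy₁ : ¬ Sees c y' b₁) (hy₂ : ¬ Sees c y' b₂)
    (hheavy : ∀ z, G.Adj x z → 3 ≤ G.degree z → z = w₁ ∨ z = w₂)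
    (hdeg₁ : 3 ≤ G.degree w₁) (hdeg₂ : 3 ≤ G.degree w₂)
    {a b : ℕ} {w : V} (ha : a < G.maxDegree + 1) (ha₁ : a ≠ b₁) (ha₂ : a ≠ b₂)
    (hb : b = b₁ ∨ b = b₂) (hw : c s(x, w) = some b) :
    ∃ d, Valid G d ∧ (bichromatic d a b).Reachable x y ∧ ¬ Sees d x a ∧ ¬ Sees d y a ∧
      d s(x, w) = some b ∧
      ∀ p q, p ≠ x → p ≠ y → q ≠ x → q ≠ y → d s(p, q) = c s(p, q) := by
  have hxy := h.adj.ne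
  have hyy' := h.adj'.ne
  have hxy' := h.ne
  have hab : a ≠ b := by rcases hb with rfl | rfl <;> assumption
  have hnear : ∀ β, β = b₁ ∨ β = b₂ → Near G (Function.update c s(y, y') (some β)) x y := by
    rintro β (rfl | rfl)
    exacts [h.near hlt₁ hy₁, h.near hlt₂ hy₂]
  have hseesy : ∀ β α, β = b₁ ∨ β = b₂ → Sees (Function.update c s(y, y') (some β)) y α → α = β :=
    fun β α hβ hs => (hnear β hβ).eq_of_sees h.nbr (Function.update_self ..) hs
  have hatx : ∀ β q, Function.update c s(y, y') (some β) s(x, q) = c s(x, q) := by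
    intro β q
    rw [update_mk]
    grind
  have hseesx : ∀ β α, Sees (Function.update c s(y, y') (some β)) x α → Sees c x α :=
    fun β α ⟨q, hq⟩ => ⟨q, (hatx β q).symm.trans hq⟩
  by_cases hxa : Sees c x a
  swap
  · refine ⟨_, (hnear b hb).valid, (hnear b hb).reachable hmin h.nbr (Function.update_self ..) ha
      fun hs => hxa (hseesx _ _ hs), fun hs => hxa (hseesx _ _ hs),
      fun hs => hab (hseesy _ _ hb hs), (hatx b w).trans hw, fun p q _ hp _ hq => ?_⟩
    rw [update_mk]
    grind
  obtain ⟨z, hz⟩ := hxa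
  have hxz : G.Adj x z := h.valid.adj hz
  have hxz' := hxz.ne
  have hyz : y ≠ z := by
    rintro rfl
    simp [h.uncolored] at hz
  have hzlt : ¬ 3 ≤ G.degree z := by
    intro hz3
    rcases hheavy z hxz hz3 with rfl | rfl
    · exact ha₁ (Option.some_injective _ (hz.symm.trans hw₁))
    · exact ha₂ (Option.some_injective _ (hz.symm.trans hw₂))
  have hzy' : z ≠ y' := by
    rintro rfl
    exact hzlt (h.three_le_degree_other hmin)
  have hneq₁ : z ≠ w₁ := by rintro rfl; exact hzlt hdeg₁
  have hneq₂ : z ≠ w₂ := by rintro rfl; exact hzlt hdeg₂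
  have hyw : ∀ v β, c s(x, v) = some β → v ≠ y := by
    rintro v β hv rfl
    simp [h.uncolored] at hv
  obtain ⟨d, hd⟩ : ∃ d, d = Function.update (Function.update c s(y, y') (some b)) s(x, z) none :=
    ⟨_, rfl⟩
  have hdv : Valid G d := hd ▸ (hnear b hb).valid.uncolor _
  have hdmk : ∀ p q, d s(p, q) = if p = x ∧ q = z ∨ p = z ∧ q = x then none else
      if p = y ∧ q = y' ∨ p = y' ∧ q = y then some b else c s(p, q) := by
    intro p q
    rw [hd, update_mk, update_mk]
  have hdx : ∀ q α, d s(x, q) = some α → q ≠ z ∧ c s(x, q) = some α := by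
    intro q α hq
    rw [hdmk] at hq
    grind
  have hdxa : ¬ Sees d x a := by
    rintro ⟨q, hq⟩
    obtain ⟨hqz, hq⟩ := hdx q a hq
    exact hqz (h.valid.proper _ _ _ _ hq hz)
  have hdle : ∀ e α, d e = some α → Function.update c s(y, y') (some b) e = some α := by
    intro e α he
    rw [hd, Function.update_apply] at he
    split_ifs at he
    exact he
  have hdy : ∀ α, Sees d y α → α = b := fun α ⟨q, hq⟩ => hseesy b α hb ⟨q, hdle _ _ hq⟩
  have hdya : ¬ Sees d y a := fun hs => hab (hdy a hs)
  have hdxw : d s(x, w) = some b := by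
    rw [hdmk, ← hw]
    have : w ≠ z := by
      rintro rfl
      exact hab (Option.some_injective _ (hz.symm.trans hw))
    grind
  by_contra hno
  have hnr : ¬ (bichromatic d a b).Reachable x y := by
    refine fun hr => hno ⟨d, hdv, hr, hdxa, hdya, hdxw, fun p q _ _ _ _ => ?_⟩
    rw [hdmk]
    grind
  have hdxy : d s(x, y) = none := by
    rw [hdmk, h.uncolored]
    grind
  have hdfull : ∀ e ∈ G.edgeSet, e ≠ s(x, y) → e ≠ s(x, z) →
      ∃ α, α < G.maxDegree + 1 ∧ d e = some α := by
    intro e he h₁ h₂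
    rw [hd, Function.update_of_ne h₂]
    exact (hnear b hb).full e he h₁
  have hnearz : Near G (Function.update d s(x, y) (some a)) x z := by
    refine ⟨hdv.color h.adj hdxy hdxa hdya fun β _ hβ => ?_, hxz, ?_, fun e he hne => ?_⟩
    · rwa [hdy β hβ]
    · rw [update_mk, hdmk]
      grind
    · by_cases hxe : e = s(x, y)
      · exact ⟨a, ha, by rw [hxe, Function.update_self]⟩
      · rw [Function.update_of_ne hxe]
        exact hdfull e he hxe hne
  have hz2 : G.degree z = 2 := by
    have := hnearz.two_le_degree hmin
    omega
  obtain ⟨z', hxz'', hzz', hznbr⟩ := exists_other_neighbor hxz hz2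
  have hzz'ne := hzz'.ne
  obtain ⟨ζ, hζlt, hζ⟩ := hnearz.full s(z, z') hzz' (by simp; grind)
  have hζc : c s(z, z') = some ζ := by
    rw [update_mk, hdmk] at hζ
    grind
  have hζb : ζ = b₁ ∨ ζ = b₂ := by
    obtain ⟨v, hv, hv3⟩ := hnearz.exists_three_le_degree hmin hznbr hζ
    have hvx := hheavy v (hnearz.valid.adj hv) hv3
    have hvy : v ≠ y := by
      have := hyw _ _ hw₁
      have := hyw _ _ hw₂
      grind
    rw [update_mk, hdmk] at hv
    grind
  obtain ⟨α, -, -, hα, -, hxα, -⟩ := h.valid.exists_unseen_pair h.adj h.uncolored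
  have hαb : α ≠ b := by rintro rfl; exact hxα ⟨w, hw⟩
  have hαa : α ≠ a := by rintro rfl; exact hxα ⟨z, hz⟩
  have hαζ : α ≠ ζ := by
    rintro rfl
    rcases hζb with rfl | rfl
    · exact hxα ⟨w₁, hw₁⟩
    · exact hxα ⟨w₂, hw₂⟩
  have hzα : ∀ β, Sees d z β → β = ζ := by
    rintro β ⟨q, hq⟩
    rcases hznbr q (hdv.adj hq) with rfl | rfl
    · rw [hdmk] at hq
      grind
    · rw [hdmk] at hq
      grind
  have hnrz : ¬ (bichromatic d α ζ).Reachable x z := by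
    intro hr
    have hle : bichromatic d α ζ ≤ bichromatic (Function.update c s(y, y') (some ζ)) α ζ := by
      refine bichromatic_mono fun e he => ?_
      induction e with
      | _ p q =>
        rw [hdmk] at he ⊢
        rw [update_mk]
        grind
    have hvζ := (hnear ζ hζb).valid
    refine hyz (hvζ.eq_of_reachable (a := α) (b := ζ) (fun hs => hxα (hseesx _ _ hs))
      (fun hs => hαζ (hseesy _ _ hζb hs)) ?_
      ((hnear ζ hζb).reachable hmin h.nbr (Function.update_self ..) hα
        fun hs => hxα (hseesx _ _ hs)) (hr.mono hle) hxy hxz')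
    rintro ⟨q, hq⟩
    have hcz : c s(z, x) = some a := by rw [Sym2.eq_swap]; exact hz
    rcases hznbr q (hvζ.adj hq) with rfl | rfl
    · rw [update_mk] at hq
      grind
    · rw [update_mk] at hq
      grind
  have hdxα : ¬ Sees d x α := fun ⟨q, hq⟩ => hxα ⟨q, (hdx q α hq).2⟩
  have hnear' : Near G (Function.update d s(x, z) (some α)) x y := by
    refine ⟨hdv.color hxz (hd ▸ Function.update_self ..) hdxα (fun hs => hαζ (hzα α hs))
      fun β _ hβ => ?_, h.adj, ?_, fun e he hne => ?_⟩
    · rwa [hzα β hβ]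
    · rw [update_mk, hdxy]
      grind
    · by_cases hxe : e = s(x, z)
      · exact ⟨α, hα, by rw [hxe, Function.update_self]⟩
      · rw [Function.update_of_ne hxe]
        exact hdfull e he hne hxe
  have hr := hnear'.reachable hmin h.nbr (b := b) (by rw [update_mk, hdmk]; grind) ha (by
    rintro ⟨q, hq⟩
    rw [update_mk] at hq
    split_ifs at hq
    · exact hαa (Option.some_injective _ hq)
    · exact hdxa ⟨q, hq⟩)
  refine hnr (hr.mono (bichromatic_mono fun e he => ?_))
  rw [Function.update_apply] at he ⊢
  grind

theorem Base.sees_of_heavy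
    (hmin : ¬ ∃ c, IsAcyclicEdgeColoring G (G.maxDegree + 1) c) (h : Base G c x y y')
    {b₁ b₂ : ℕ} {w₁ w₂ : V} (hw₁ : c s(x, w₁) = some b₁) (hw₂ : c s(x, w₂) = some b₂)
    (hlt₁ : b₁ < G.maxDegree + 1) (hlt₂ : b₂ < G.maxDegree + 1)
    (hy₁ : ¬ Sees c y' b₁) (hy₂ : ¬ Sees c y' b₂)
    (hheavy : ∀ z, G.Adj x z → 3 ≤ G.degree z → z = w₁ ∨ z = w₂)
    (hdeg₁ : 3 ≤ G.degree w₁) (hdeg₂ : 3 ≤ G.degree w₂)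
    {a : ℕ} (ha : a < G.maxDegree + 1) (ha₁ : a ≠ b₁) (ha₂ : a ≠ b₂) : Sees c w₁ a := by
  have hne : y ≠ w₁ := by
    rintro rfl
    simp [h.uncolored] at hw₁
  have hxw := (h.valid.adj hw₁).ne
  obtain ⟨d, hd, hr, hdx, hdy, hdw, hdc⟩ := h.exists_reachable hmin hw₁ hw₂ hlt₁ hlt₂ hy₁ hy₂
    hheavy hdeg₁ hdeg₂ ha ha₁ ha₂ (Or.inl rfl) hw₁
  obtain ⟨q, hq⟩ := hd.sees_of_reachable hr hdx hdw h.adj.ne' hne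
  refine ⟨q, ?_⟩
  rw [← hdc w₁ q hxw.symm hne.symm ?_ ?_]
  · exact hq
  · rintro rfl
    exact hdx ⟨w₁, Sym2.eq_swap ▸ hq⟩
  · rintro rfl
    exact hdy ⟨w₁, Sym2.eq_swap ▸ hq⟩

/-- The two neighbors of `x` of degree at least three are not adjacent. -/
theorem Base.not_adj_of_heavy
    (hmin : ¬ ∃ c, IsAcyclicEdgeColoring G (G.maxDegree + 1) c) (h : Base G c x y y')
    {b₁ b₂ : ℕ} {w₁ w₂ : V} (hw₁ : c s(x, w₁) = some b₁) (hw₂ : c s(x, w₂) = some b₂)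
    (hlt₁ : b₁ < G.maxDegree + 1) (hlt₂ : b₂ < G.maxDegree + 1)
    (hy₁ : ¬ Sees c y' b₁) (hy₂ : ¬ Sees c y' b₂)
    (hheavy : ∀ z, G.Adj x z → 3 ≤ G.degree z → z = w₁ ∨ z = w₂)
    (hdeg₁ : 3 ≤ G.degree w₁) (hdeg₂ : 3 ≤ G.degree w₂) : ¬ G.Adj w₁ w₂ := by
  intro hadj
  have hne := hadj.ne
  have hyw : ∀ v β, c s(x, v) = some β → y ≠ v := by
    rintro v β hv rfl
    simp [h.uncolored] at hv
  have hyw₁ := hyw _ _ hw₁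
  have hyw₂ := hyw _ _ hw₂
  have hxw₁ := (h.valid.adj hw₁).ne
  have hxw₂ := (h.valid.adj hw₂).ne
  obtain ⟨δ, hδlt, hδ⟩ := h.full s(w₁, w₂) hadj (by simp; grind)
    (by simp; grind)
  have hδ₁ : δ ≠ b₁ := by
    rintro rfl
    exact hxw₂ (h.valid.proper w₁ x w₂ δ (Sym2.eq_swap ▸ hw₁) hδ)
  have hδ₂ : δ ≠ b₂ := by
    rintro rfl
    exact hxw₁ (h.valid.proper w₂ x w₁ δ (Sym2.eq_swap ▸ hw₂) (Sym2.eq_swap ▸ hδ))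
  obtain ⟨d, hd, hr, hdx, hdy, hdw, hdc⟩ := h.exists_reachable hmin hw₁ hw₂ hlt₁ hlt₂ hy₁ hy₂
    hheavy hdeg₁ hdeg₂ hδlt hδ₁ hδ₂ (Or.inr rfl) hw₂
  have hdδ : d s(w₂, w₁) = some δ := by
    rw [hdc _ _ hxw₂.symm hyw₂.symm hxw₁.symm hyw₁.symm, Sym2.eq_swap, hδ]
  have hsees : Sees c w₁ b₂ := by
    obtain ⟨q, hq⟩ := hd.sees_third_of_reachable hr hdx hdw hdδ h.adj.ne' hyw₂ hyw₁
    refine ⟨q, ?_⟩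
    rw [← hdc w₁ q hxw₁.symm hyw₁.symm ?_ ?_]
    · exact hq
    · rintro rfl
      exact hne (hd.proper _ _ _ _ (Sym2.eq_swap ▸ hq) hdw)
    · rintro rfl
      rcases h.nbr w₁ (hd.adj hq).symm with e | e
      · exact hxw₁ e.symm
      · exact hy₁ ⟨x, by rw [← e, Sym2.eq_swap]; exact hw₁⟩
  obtain ⟨a, ha, hwa⟩ := h.valid.exists_unseen w₁
  by_cases ha₁ : a = b₁
  · exact hwa ⟨x, by rw [Sym2.eq_swap, ha₁]; exact hw₁⟩
  by_cases ha₂ : a = b₂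
  · exact hwa (ha₂ ▸ hsees)
  exact hwa (h.sees_of_heavy hmin hw₁ hw₂ hlt₁ hlt₂ hy₁ hy₂ hheavy hdeg₁ hdeg₂ ha ha₁ ha₂)

/-- The neighbors of `x` of degree at least three, in the coloring left by deleting an edge from
`x` to a vertex `y` of degree two. -/
theorem exists_base (hmin : ¬ ∃ c, IsAcyclicEdgeColoring G (G.maxDegree + 1) c)
    (hdel : ∀ e ∈ G.edgeSet, ∃ c : Sym2 V → Option ℕ,
      IsAcyclicEdgeColoring (G.deleteEdges {e}) (G.maxDegree + 1) c)
    (hxdeg3 : ((G.neighborFinset x).filter fun z => 3 ≤ G.degree z).card ≤ 2)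
    (hadj : G.Adj x y) (hdeg : G.degree y = 2) :
    ∃ c y' b₁ b₂ w₁ w₂, Base G c x y y' ∧ c s(x, w₁) = some b₁ ∧ c s(x, w₂) = some b₂ ∧
      b₁ < G.maxDegree + 1 ∧ b₂ < G.maxDegree + 1 ∧ ¬ Sees c y' b₁ ∧ ¬ Sees c y' b₂ ∧
      (∀ z, G.Adj x z → 3 ≤ G.degree z → z = w₁ ∨ z = w₂) ∧
      3 ≤ G.degree w₁ ∧ 3 ≤ G.degree w₂ := by
  obtain ⟨y', hne, hadj', hnbr⟩ := exists_other_neighbor hadj hdeg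
  obtain ⟨c₀, hc₀⟩ := exists_near hdel hadj
  have h := hc₀.base hadj' hne hnbr
  set c := Function.update c₀ s(y, y') none
  obtain ⟨b₁, b₂, hb, hlt₁, hlt₂, hy₁, hy₂⟩ :=
    h.valid.exists_unseen_pair h.adj'.symm (Sym2.eq_swap ▸ h.uncolored')
  obtain ⟨w₁, hw₁, hdeg₁⟩ := h.exists_three_le_degree hmin hlt₁ hy₁
  obtain ⟨w₂, hw₂, hdeg₂⟩ := h.exists_three_le_degree hmin hlt₂ hy₂
  refine ⟨c, y', b₁, b₂, w₁, w₂, h, hw₁, hw₂, hlt₁, hlt₂, hy₁, hy₂, fun z hz hz3 => ?_,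
    hdeg₁, hdeg₂⟩
  by_contra! hzw
  have hw : w₁ ≠ w₂ := by
    rintro rfl
    exact hb (Option.some_injective _ (hw₁.symm.trans hw₂))
  have hsub : ({z, w₁, w₂} : Finset V) ⊆
      (G.neighborFinset x).filter fun z => 3 ≤ G.degree z := by
    intro v hv
    simp only [Finset.mem_insert, Finset.mem_singleton] at hv
    rw [Finset.mem_filter, G.mem_neighborFinset]
    rcases hv with rfl | rfl | rfl
    exacts [⟨hz, hz3⟩, ⟨h.valid.adj hw₁, hdeg₁⟩, ⟨h.valid.adj hw₂, hdeg₂⟩]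
  have := Finset.card_le_card hsub
  rw [Finset.card_eq_three.2 ⟨z, w₁, w₂, hzw.1, hzw.2, hw, rfl⟩] at this
  omega

/-- A neighbor of `x` of degree two lies in no triangle with `x`. -/
theorem not_adj_of_degree_eq_two (hmin : ¬ ∃ c, IsAcyclicEdgeColoring G (G.maxDegree + 1) c)
    (hdel : ∀ e ∈ G.edgeSet, ∃ c : Sym2 V → Option ℕ,
      IsAcyclicEdgeColoring (G.deleteEdges {e}) (G.maxDegree + 1) c)
    (hxdeg3 : ((G.neighborFinset x).filter fun z => 3 ≤ G.degree z).card ≤ 2)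
    (hadj : G.Adj x y) (hdeg : G.degree y = 2) {v : V} (hv : G.Adj x v) : ¬ G.Adj y v := by
  intro hyv
  obtain ⟨c, y', b₁, b₂, w₁, w₂, h, hw₁, hw₂, -, -, hy₁, hy₂, hheavy, -, -⟩ :=
    exists_base hmin hdel hxdeg3 hadj hdeg
  obtain rfl : v = y' := (h.nbr v hyv).resolve_left hv.ne'
  rcases hheavy v hv (h.three_le_degree_other hmin) with rfl | rfl
  · exact hy₁ ⟨x, Sym2.eq_swap ▸ hw₁⟩
  · exact hy₂ ⟨x, Sym2.eq_swap ▸ hw₂⟩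

end Near

/-- Lemma 11(a): in the minimum-counterexample setup, no two neighbors of
`x` are adjacent in `G`. -/
theorem neighbors_of_pivot_nonadjacent
    {V : Type*} [Fintype V] [DecidableEq V] (G : SimpleGraph V) [DecidableRel G.Adj]
    (h2deg : TwoDegenerate G)
    (hmin : ¬ ∃ c : Sym2 V → Option ℕ, IsAcyclicEdgeColoring G (G.maxDegree + 1) c)
    (hdel : ∀ e ∈ G.edgeSet, ∃ c : Sym2 V → Option ℕ,
      IsAcyclicEdgeColoring (G.deleteEdges {e}) (G.maxDegree + 1) c)
    (x : V)
    (hxdeg2 : ∃ z, G.Adj x z ∧ G.degree z = 2)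
    (hxdeg3 : ((G.neighborFinset x).filter fun z => 3 ≤ G.degree z).card ≤ 2) :
    ∀ u v, G.Adj x u → G.Adj x v → ¬ G.Adj u v := by
  intro u v hu hv huv
  have h2 : ∀ z, G.Adj x z → 2 ≤ G.degree z := fun z hz =>
    let ⟨_, hc⟩ := exists_near hdel hz
    hc.two_le_degree hmin
  by_cases hu2 : G.degree u = 2
  · exact not_adj_of_degree_eq_two hmin hdel hxdeg3 hu hu2 hv huv
  by_cases hv2 : G.degree v = 2
  · exact not_adj_of_degree_eq_two hmin hdel hxdeg3 hv hv2 hu huv.symm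
  obtain ⟨y, hy, hy2⟩ := hxdeg2
  obtain ⟨c, y', b₁, b₂, w₁, w₂, h, hw₁, hw₂, hlt₁, hlt₂, hy₁, hy₂, hheavy, hdeg₁, hdeg₂⟩ :=
    exists_base hmin hdel hxdeg3 hy hy2
  have hnot := h.not_adj_of_heavy hmin hw₁ hw₂ hlt₁ hlt₂ hy₁ hy₂ hheavy hdeg₁ hdeg₂
  have hu3 := h2 u hu
  have hv3 := h2 v hv
  rcases hheavy u hu (by omega) with rfl | rfl <;>
    rcases hheavy v hv (by omega) with rfl | rfl
  exacts [huv.ne rfl, hnot huv, hnot huv.symm, huv.ne rfl]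

end AEC
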